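/- arXiv:2212.02463 — 11 statements merged into one kernel-verified Lean document; each statement's English description precedes it below -/
import Mathlib

section
/- Subcritical extinction of the Karp–Sipser fluid limit: let p₁ > 0 and p₂, p₃ ≥ 0 with p₁ + p₂ + p₃ = 1 and Θ := (p₃ − p₁)² − 4p₁ < 0. If (𝒳,𝒴,𝒵) is a solution of the fluid-limit equation on [0,T] with initial condition (p₁,p₂,p₃), then 𝒳(T) = 𝒴(T) = 𝒵(T) = 0, and there exists t₀ ∈ [0,T) such that 𝒵(t) < 𝒳(t) for all t ∈ (t₀, T). -/
/-- First coordinate of the Karp--Sipser fluid-limit vector field. -/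
noncomputable def phiX (x y z : ℝ) : ℝ :=
  -2*x/(x+y+z) - y*z/(x+y+z)^2 - 2*x*y/(x+y+z)^2
    + (y^2*z - 3*x^2*z - 2*x*y*z - z^3 - 4*x*z^2)/(x+y+z)^3

/-- Second coordinate of the Karp--Sipser fluid-limit vector field. -/
noncomputable def phiY (x y z : ℝ) : ℝ :=
  -2*x*y/(x+y+z)^2 - 4*y^2/(x+y+z)^2
    + (4*z^3 - 4*y^2*z - 4*x*y*z + 4*x*z^2)/(x+y+z)^3

/-- Third coordinate of the Karp--Sipser fluid-limit vector field. -/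
noncomputable def phiZ (x y z : ℝ) : ℝ :=
  -3*y*z/(x+y+z)^2
    + (-3*y^2*z - 12*y*z^2 - 3*x^2*z - 6*x*y*z - 12*x*z^2 - 9*z^3)/(x+y+z)^3

theorem phiX_add_phiY_add_phiZ {x y z : ℝ} (h : x + y + z ≠ 0) :
    phiX x y z + phiY x y z + phiZ x y z = -2 * (x + 2 * y + 3 * z) / (x + y + z) := by
  unfold phiX phiY phiZ
  field_simp
  ring

theorem phiX_eq {x y z : ℝ} (h : x + y + z ≠ 0) :
    phiX x y z = (-x * (x + 2 * y + 3 * z) - 2 * x * (x + y + z) + x ^ 2 - z ^ 2)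
      / (x + y + z) ^ 2 := by
  unfold phiX
  field_simp
  ring

theorem phiZ_eq {x y z : ℝ} (h : x + y + z ≠ 0) :
    phiZ x y z = -3 * z * (x + 2 * y + 3 * z) / (x + y + z) ^ 2 := by
  unfold phiZ
  field_simp
  ring

theorem eq_left_of_hasDerivWithinAt_Icc_zero {T : ℝ} {f : ℝ → ℝ}
    (hf : ∀ t ∈ Set.Ico (0 : ℝ) T, HasDerivWithinAt f 0 (Set.Icc 0 T) t) :
    ∀ t ∈ Set.Ico (0 : ℝ) T, f t = f 0 := by
  intro t ht
  refine constant_of_has_deriv_right_zero (a := 0) (b := t) ?_ ?_ t ⟨ht.1, le_rfl⟩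
  · intro u hu
    exact (hf u ⟨hu.1, hu.2.trans_lt ht.2⟩).continuousWithinAt.mono
      (Set.Icc_subset_Icc_right ht.2.le)
  · intro u hu
    have huT : u < T := hu.2.trans ht.2
    exact ((hf u ⟨hu.1, huT⟩).mono (Set.Icc_subset_Icc_left hu.1)).mono_of_mem_nhdsWithin
      (Icc_mem_nhdsGE huT)

/-- The quantity `((z - x)² - 4 x s) / s²` is a first integral of the fluid-limit vector field. -/
theorem hasDerivWithinAt_discriminant_div {X Y Z : ℝ → ℝ} {s : Set ℝ} {t : ℝ}
    (h : X t + Y t + Z t ≠ 0)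
    (hX : HasDerivWithinAt X (phiX (X t) (Y t) (Z t)) s t)
    (hY : HasDerivWithinAt Y (phiY (X t) (Y t) (Z t)) s t)
    (hZ : HasDerivWithinAt Z (phiZ (X t) (Y t) (Z t)) s t) :
    HasDerivWithinAt (fun u => ((Z u - X u) ^ 2 - 4 * X u * (X u + Y u + Z u))
      / (X u + Y u + Z u) ^ 2) 0 s t := by
  have hS : HasDerivWithinAt (fun u => X u + Y u + Z u) _ s t := (hX.add hY).add hZ
  rw [phiX_add_phiY_add_phiZ h] at hS
  rw [phiX_eq h] at hX
  rw [phiZ_eq h] at hZ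
  refine ((((hZ.fun_sub hX).fun_pow 2).fun_sub ((hX.const_mul 4).fun_mul hS)).fun_div
    (hS.fun_pow 2) (pow_ne_zero 2 h)).congr_deriv ?_
  push_cast
  field_simp
  ring

/-- The quantity `z² / s³` is a first integral of the fluid-limit vector field. -/
theorem hasDerivWithinAt_sq_div_cube {X Y Z : ℝ → ℝ} {s : Set ℝ} {t : ℝ}
    (h : X t + Y t + Z t ≠ 0)
    (hX : HasDerivWithinAt X (phiX (X t) (Y t) (Z t)) s t)
    (hY : HasDerivWithinAt Y (phiY (X t) (Y t) (Z t)) s t)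
    (hZ : HasDerivWithinAt Z (phiZ (X t) (Y t) (Z t)) s t) :
    HasDerivWithinAt (fun u => Z u ^ 2 / (X u + Y u + Z u) ^ 3) 0 s t := by
  have hS : HasDerivWithinAt (fun u => X u + Y u + Z u) _ s t := (hX.add hY).add hZ
  rw [phiX_add_phiY_add_phiZ h] at hS
  rw [phiZ_eq h] at hZ
  refine ((hZ.fun_pow 2).fun_div (hS.fun_pow 3) (pow_ne_zero 3 h)).congr_deriv ?_
  push_cast
  field_simp
  ring

/-- **Subcritical extinction of the Karp--Sipser fluid limit.** -/
theorem subcritical_extinction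
    (p1 p2 p3 : ℝ) (hp1 : 0 < p1) (hp2 : 0 ≤ p2) (hp3 : 0 ≤ p3)
    (hsum : p1 + p2 + p3 = 1)
    (hTheta : (p3 - p1)^2 - 4*p1 < 0)
    (T : ℝ) (hT : 0 < T) (X Y Z : ℝ → ℝ)
    (hXc : ContinuousOn X (Set.Icc 0 T)) (hYc : ContinuousOn Y (Set.Icc 0 T))
    (hZc : ContinuousOn Z (Set.Icc 0 T))
    (hXnn : ∀ t ∈ Set.Icc (0:ℝ) T, 0 ≤ X t)
    (hYnn : ∀ t ∈ Set.Icc (0:ℝ) T, 0 ≤ Y t)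
    (hZnn : ∀ t ∈ Set.Icc (0:ℝ) T, 0 ≤ Z t)
    (hX0 : X 0 = p1) (hY0 : Y 0 = p2) (hZ0 : Z 0 = p3)
    (hXpos : ∀ t ∈ Set.Ico (0:ℝ) T, 0 < X t)
    (hSpos : ∀ t ∈ Set.Ico (0:ℝ) T, 0 < X t + Y t + Z t)
    (hXT : X T = 0)
    (hX' : ∀ t ∈ Set.Ico (0:ℝ) T,
      HasDerivWithinAt X (phiX (X t) (Y t) (Z t)) (Set.Icc 0 T) t)
    (hY' : ∀ t ∈ Set.Ico (0:ℝ) T,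
      HasDerivWithinAt Y (phiY (X t) (Y t) (Z t)) (Set.Icc 0 T) t)
    (hZ' : ∀ t ∈ Set.Ico (0:ℝ) T,
      HasDerivWithinAt Z (phiZ (X t) (Y t) (Z t)) (Set.Icc 0 T) t) :
    X T = 0 ∧ Y T = 0 ∧ Z T = 0 ∧
      ∃ t0 ∈ Set.Ico (0:ℝ) T, ∀ t ∈ Set.Ioo t0 T, Z t < X t := by
  have hS0 : X 0 + Y 0 + Z 0 = 1 := by rw [hX0, hY0, hZ0, hsum]
  have hSc : ContinuousOn (fun u => X u + Y u + Z u) (Set.Icc 0 T) := (hXc.add hYc).add hZc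
  set θ : ℝ := (p3 - p1) ^ 2 - 4 * p1 with hθ
  have hdisc : ∀ t ∈ Set.Ico (0 : ℝ) T,
      (Z t - X t) ^ 2 - 4 * X t * (X t + Y t + Z t) = θ * (X t + Y t + Z t) ^ 2 := by
    intro t ht
    have h := eq_left_of_hasDerivWithinAt_Icc_zero (fun u hu =>
      hasDerivWithinAt_discriminant_div (hSpos u hu).ne' (hX' u hu) (hY' u hu) (hZ' u hu)) t ht
    simp only [hS0] at h
    rw [div_eq_iff (pow_ne_zero 2 (hSpos t ht).ne')] at h
    rw [h, hX0, hZ0, hθ]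
    ring
  have hcube : ∀ t ∈ Set.Ico (0 : ℝ) T, Z t ^ 2 = p3 ^ 2 * (X t + Y t + Z t) ^ 3 := by
    intro t ht
    have h := eq_left_of_hasDerivWithinAt_Icc_zero (fun u hu =>
      hasDerivWithinAt_sq_div_cube (hSpos u hu).ne' (hX' u hu) (hY' u hu) (hZ' u hu)) t ht
    simp only [hS0] at h
    rw [div_eq_iff (pow_ne_zero 3 (hSpos t ht).ne')] at h
    rw [h, hZ0]
    ring
  have hTmem : T ∈ Set.Icc (0 : ℝ) T := ⟨hT.le, le_rfl⟩
  have hdiscT : (Z T - X T) ^ 2 - 4 * X T * (X T + Y T + Z T) = θ * (X T + Y T + Z T) ^ 2 := by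
    have hEq : Set.EqOn (fun t => (Z t - X t) ^ 2 - 4 * X t * (X t + Y t + Z t))
        (fun t => θ * (X t + Y t + Z t) ^ 2) (Set.Icc 0 T) :=
      Set.EqOn.of_subset_closure hdisc (by fun_prop) (by fun_prop) Set.Ico_subset_Icc_self
        (closure_Ico hT.ne).ge
    exact hEq hTmem
  have hST : X T + Y T + Z T = 0 := by
    by_contra hne
    have hpos : 0 < (X T + Y T + Z T) ^ 2 := by positivity
    rw [hXT] at hdiscT hpos
    nlinarith [sq_nonneg (Z T), mul_pos (neg_pos.2 hTheta) hpos]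
  have hYT := hYnn T hTmem
  have hZT := hZnn T hTmem
  refine ⟨hXT, by linarith, by linarith, ?_⟩
  have hlim : Filter.Tendsto (fun t => p3 ^ 2 * (X t + Y t + Z t))
      (nhdsWithin T (Set.Iio T)) (nhds 0) := by
    have h := (hSc T hTmem).mono_of_mem_nhdsWithin (Icc_mem_nhdsLT hT)
    have h' := h.tendsto.const_mul (p3 ^ 2)
    simpa only [hST, mul_zero] using h'
  have hev : ∀ᶠ t in nhdsWithin T (Set.Iio T),
      p3 ^ 2 * (X t + Y t + Z t) < (θ / 4) ^ 2 :=
    hlim.eventually_lt_const (by have := hTheta.ne; positivity)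
  obtain ⟨t0, ht0, hsub⟩ := (mem_nhdsLT_iff_exists_mem_Ico_Ioo_subset hT).1 hev
  refine ⟨t0, ht0, fun t ht => ?_⟩
  have htI : t ∈ Set.Ico (0 : ℝ) T := ⟨ht0.1.trans ht.1.le, ht.2⟩
  have hs := hSpos t htI
  have hXge : -θ / 4 * (X t + Y t + Z t) ≤ X t := by
    refine le_of_mul_le_mul_right ?_ hs
    nlinarith [hdisc t htI, sq_nonneg (Z t - X t)]
  have hZlt : Z t ^ 2 < (-θ / 4 * (X t + Y t + Z t)) ^ 2 := by
    have h := mul_lt_mul_of_pos_right (hsub ht) (pow_pos hs 2)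
    rw [hcube t htI]
    linarith
  have hnn : 0 ≤ -θ / 4 * (X t + Y t + Z t) := mul_nonneg (by linarith) hs.le
  exact (lt_of_pow_lt_pow_left₀ 2 hnn hZlt).trans_le hXge
end

section
/- Reduction of the fluid-limit equation to proportions: let I be an interval and (𝒳,𝒴,𝒵) : I → ℝ³ be differentiable with S := 𝒳 + 𝒴 + 𝒵 > 0 on I and (𝒳',𝒴',𝒵')(t) = φ((𝒳,𝒴,𝒵)(t)) for all t ∈ I. Set x := 𝒳/S and z := 𝒵/S. Then on I one has x' = (x − z)·z / S, z' = (−2 + x − z)·z / S, and S' = 2(−2 + x − z). -/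
/-- **Reduction of the fluid-limit equation to proportions.** -/
theorem proportions_system
    (I : Set ℝ) (hI : I.OrdConnected)
    (X Y Z : ℝ → ℝ)
    (hSpos : ∀ t ∈ I, 0 < X t + Y t + Z t)
    (hX' : ∀ t ∈ I, HasDerivWithinAt X (phiX (X t) (Y t) (Z t)) I t)
    (hY' : ∀ t ∈ I, HasDerivWithinAt Y (phiY (X t) (Y t) (Z t)) I t)
    (hZ' : ∀ t ∈ I, HasDerivWithinAt Z (phiZ (X t) (Y t) (Z t)) I t) :
    ∀ t ∈ I,
      HasDerivWithinAt (fun u => X u / (X u + Y u + Z u))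
        ((X t / (X t + Y t + Z t) - Z t / (X t + Y t + Z t))
          * (Z t / (X t + Y t + Z t)) / (X t + Y t + Z t)) I t ∧
      HasDerivWithinAt (fun u => Z u / (X u + Y u + Z u))
        ((-2 + X t / (X t + Y t + Z t) - Z t / (X t + Y t + Z t))
          * (Z t / (X t + Y t + Z t)) / (X t + Y t + Z t)) I t ∧
      HasDerivWithinAt (fun u => X u + Y u + Z u)
        (2 * (-2 + X t / (X t + Y t + Z t) - Z t / (X t + Y t + Z t))) I t := by
  intro t ht
  have hs := (hSpos t ht).ne'
  have hS := ((hX' t ht).add (hY' t ht)).add (hZ' t ht)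
  refine ⟨((hX' t ht).div hS hs).congr_deriv ?_, ((hZ' t ht).div hS hs).congr_deriv ?_,
    hS.congr_deriv ?_⟩ <;>
  · simp only [phiX, phiY, phiZ, Pi.add_apply]
    field_simp
    ring
end

section
/- A first integral of the fluid-limit equation: let I be an interval and (𝒳,𝒴,𝒵) : I → ℝ³ be differentiable with S := 𝒳 + 𝒴 + 𝒵 > 0 and 𝒵 > 0 on I, and with (𝒳',𝒴',𝒵')(t) = φ((𝒳,𝒴,𝒵)(t)) for all t ∈ I. Then the function t ↦ S(t)³ / 𝒵(t)² is constant on I. -/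
/-- The infinitesimal form of the conservation law: `3 z (φ_X + φ_Y + φ_Z) = 2 s φ_Z`. -/
theorem three_mul_phi_sum (x y z : ℝ) (hs : x + y + z ≠ 0) :
    3 * z * (phiX x y z + phiY x y z + phiZ x y z) = 2 * (x + y + z) * phiZ x y z := by
  unfold phiX phiY phiZ
  field_simp
  ring

/-- `S³ / Z²` has zero derivative wherever `3 Z S' = 2 S Z'`. -/
theorem hasDerivWithinAt_cube_div_sq {S Z : ℝ → ℝ} {S' Z' t : ℝ} {I : Set ℝ}
    (hS : HasDerivWithinAt S S' I t) (hZ : HasDerivWithinAt Z Z' I t)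
    (hZ0 : Z t ≠ 0) (h : 3 * Z t * S' = 2 * S t * Z') :
    HasDerivWithinAt (fun u => S u ^ 3 / Z u ^ 2) 0 I t := by
  refine ((hS.fun_pow 3).fun_div (hZ.fun_pow 2) (pow_ne_zero 2 hZ0)).congr_deriv ?_
  rw [div_eq_zero_iff]
  left
  push_cast
  linear_combination S t ^ 2 * Z t * h

/-- **A first integral of the fluid-limit equation:** `S³/𝒵²` is constant along the flow. -/
theorem first_integral_constant
    (I : Set ℝ) (hI : I.OrdConnected)
    (X Y Z : ℝ → ℝ)
    (hSpos : ∀ t ∈ I, 0 < X t + Y t + Z t)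
    (hZpos : ∀ t ∈ I, 0 < Z t)
    (hX' : ∀ t ∈ I, HasDerivWithinAt X (phiX (X t) (Y t) (Z t)) I t)
    (hY' : ∀ t ∈ I, HasDerivWithinAt Y (phiY (X t) (Y t) (Z t)) I t)
    (hZ' : ∀ t ∈ I, HasDerivWithinAt Z (phiZ (X t) (Y t) (Z t)) I t) :
    ∀ s ∈ I, ∀ t ∈ I,
      (X s + Y s + Z s)^3 / (Z s)^2 = (X t + Y t + Z t)^3 / (Z t)^2 := by
  intro s hs t ht
  have hderiv : ∀ u ∈ I, HasDerivWithinAt (fun u => (X u + Y u + Z u) ^ 3 / Z u ^ 2) 0 I u :=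
    fun u hu => hasDerivWithinAt_cube_div_sq (((hX' u hu).fun_add (hY' u hu)).fun_add (hZ' u hu))
      (hZ' u hu) (hZpos u hu).ne' (three_mul_phi_sum _ _ _ (hSpos u hu).ne')
  have hbound := hI.convex.norm_image_sub_le_of_norm_hasDerivWithin_le
    (C := 0) hderiv (fun _ _ => norm_zero.le) ht hs
  rw [zero_mul] at hbound
  exact sub_eq_zero.mp (norm_le_zero_iff.mp hbound)
end

section
/- Scalar second-order equation for z̃: let I be an open interval and x̃, z̃ : I → ℝ be differentiable functions satisfying the autonomous Karp–Sipser system x̃' = (x̃ − z̃)·z̃ and z̃' = (−2 + x̃ − z̃)·z̃ on I, with z̃ > 0 on I. Then z̃ is twice differentiable on I and satisfies 2·z̃³ = z̃''·z̃ − (z̃')² on I. -/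
/-- **Scalar second-order equation for z̃:** if `(x̃, z̃)` solves the autonomous Karp--Sipser
system on an open interval with `z̃ > 0`, then `z̃` is twice differentiable (i.e. its
derivative `u ↦ (−2 + x̃ − z̃)·z̃` is differentiable) and satisfies
`2 z̃³ = z̃'' z̃ − (z̃')²`. -/
theorem scalar_second_order_equation
    (a b : ℝ) (x z : ℝ → ℝ)
    (hzpos : ∀ u ∈ Set.Ioo a b, 0 < z u)
    (hx : ∀ u ∈ Set.Ioo a b, HasDerivAt x ((x u - z u) * z u) u)
    (hz : ∀ u ∈ Set.Ioo a b, HasDerivAt z ((-2 + x u - z u) * z u) u) :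
    ∀ u ∈ Set.Ioo a b, ∃ d : ℝ,
      HasDerivAt (fun v => (-2 + x v - z v) * z v) d u ∧
      2 * (z u)^3 = d * z u - ((-2 + x u - z u) * z u)^2 := by
  intro u hu
  have hp : HasDerivAt (fun v => -2 + x v - z v) (2 * z u) u := by
    refine (((hx u hu).const_add (-2)).sub (hz u hu)).congr_deriv ?_
    ring
  refine ⟨_, hp.mul (hz u hu), ?_⟩
  ring
end

section
/- The explicit family solves the autonomous system: for every b > 0 and u₀ ∈ ℝ, the functions z̃(u) = b²/sinh²(b(u+u₀)) and x̃(u) = (b·coth(b(u+u₀)) − 1)² + 1 − b², defined for u > −u₀, satisfy x̃'(u) = (x̃(u) − z̃(u))·z̃(u) and z̃'(u) = (−2 + x̃(u) − z̃(u))·z̃(u) for all u > −u₀; moreover 1 − x̃(u) − z̃(u) = −2b²·coth²(b(u+u₀)) + 2b·coth(b(u+u₀)) + 2b² − 1 for all u > −u₀. -/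
/-- Hyperbolic cotangent. -/
noncomputable def coth (w : ℝ) : ℝ := Real.cosh w / Real.sinh w

/-- Explicit `z̃` of the family of solutions of the autonomous Karp--Sipser system. -/
noncomputable def ksZt (b u0 u : ℝ) : ℝ := b^2 / Real.sinh (b*(u+u0))^2

/-- Explicit `x̃` of the family of solutions of the autonomous Karp--Sipser system. -/
noncomputable def ksXt (b u0 u : ℝ) : ℝ := (b * coth (b*(u+u0)) - 1)^2 + 1 - b^2

theorem coth_sq {w : ℝ} (hw : w ≠ 0) : coth w ^ 2 = 1 + 1 / Real.sinh w ^ 2 := by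
  have hs : Real.sinh w ≠ 0 := Real.sinh_ne_zero.mpr hw
  rw [coth, div_pow, Real.cosh_sq]
  field_simp

theorem hasDerivAt_coth {w : ℝ} (hw : w ≠ 0) :
    HasDerivAt coth (-(1 / Real.sinh w ^ 2)) w := by
  have hs : Real.sinh w ≠ 0 := Real.sinh_ne_zero.mpr hw
  refine ((Real.hasDerivAt_cosh w).div (Real.hasDerivAt_sinh w) hs).congr_deriv ?_
  rw [← neg_div]
  congr 1
  linear_combination -Real.cosh_sq w

theorem ksZt_eq_coth {b u0 u : ℝ} (hw : b * (u + u0) ≠ 0) :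
    ksZt b u0 u = b ^ 2 * (coth (b * (u + u0)) ^ 2 - 1) := by
  rw [ksZt, coth_sq hw]
  ring

theorem ksXt_sub_ksZt {b u0 u : ℝ} (hw : b * (u + u0) ≠ 0) :
    ksXt b u0 u - ksZt b u0 u = 2 - 2 * b * coth (b * (u + u0)) := by
  rw [ksZt_eq_coth hw, ksXt]
  ring

/-- **The explicit family solves the autonomous Karp--Sipser system**, and the
corresponding y-proportion has the stated closed form. -/
theorem explicit_family_solves
    (b u0 : ℝ) (hb : 0 < b) :
    ∀ u : ℝ, -u0 < u →
      HasDerivAt (ksXt b u0) ((ksXt b u0 u - ksZt b u0 u) * ksZt b u0 u) u ∧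
      HasDerivAt (ksZt b u0) ((-2 + ksXt b u0 u - ksZt b u0 u) * ksZt b u0 u) u ∧
      1 - ksXt b u0 u - ksZt b u0 u
        = -2*b^2 * coth (b*(u+u0))^2 + 2*b * coth (b*(u+u0)) + 2*b^2 - 1 := by
  intro u hu
  have hw : b * (u + u0) ≠ 0 := (mul_pos hb (by linarith)).ne'
  have hs : Real.sinh (b * (u + u0)) ≠ 0 := Real.sinh_ne_zero.mpr hw
  have hlin : HasDerivAt (fun v : ℝ => b * (v + u0)) b u := by
    simpa using ((hasDerivAt_id u).add_const u0).const_mul b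
  refine ⟨?_, ?_, ?_⟩
  · have h := (((((hasDerivAt_coth hw).comp u hlin).const_mul b).sub_const 1).pow 2).add_const 1
      |>.sub_const (b ^ 2)
    refine h.congr_deriv ?_
    rw [ksXt_sub_ksZt hw, ksZt]
    simp only [Function.comp_apply]
    ring
  · have h := (hasDerivAt_const u (b ^ 2)).div (hlin.sinh.pow 2) (pow_ne_zero 2 hs)
    refine h.congr_deriv ?_
    rw [add_sub_assoc, ksXt_sub_ksZt hw, ksZt, coth]
    simp only [Pi.pow_apply]
    field_simp
    ring
  · rw [ksZt_eq_coth hw, ksXt]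
    ring
end

section
/- Conserved quantity of the autonomous system: let I be an interval and x̃, z̃ : I → ℝ be differentiable functions satisfying x̃' = (x̃ − z̃)·z̃ and z̃' = (−2 + x̃ − z̃)·z̃ on I. Then the function u ↦ (z̃(u) − x̃(u))² − 4·x̃(u) is constant on I. -/
/-- **Conserved quantity of the autonomous Karp--Sipser system:** along any solution
`(x̃, z̃)` of `x̃' = (x̃ − z̃)·z̃`, `z̃' = (−2 + x̃ − z̃)·z̃` on an interval,
the quantity `(z̃ − x̃)² − 4x̃` is constant. -/
theorem conserved_quantity
    (I : Set ℝ) (hI : I.OrdConnected)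
    (x z : ℝ → ℝ)
    (hx : ∀ u ∈ I, HasDerivWithinAt x ((x u - z u) * z u) I u)
    (hz : ∀ u ∈ I, HasDerivWithinAt z ((-2 + x u - z u) * z u) I u) :
    ∀ u ∈ I, ∀ v ∈ I,
      (z u - x u)^2 - 4 * x u = (z v - x v)^2 - 4 * x v := by
  intro u hu v hv
  have hderiv : ∀ w ∈ I,
      HasDerivWithinAt (fun w => (z w - x w) ^ 2 - 4 * x w) 0 I w := by
    intro w hw
    refine ((((hz w hw).fun_sub (hx w hw)).fun_pow 2).fun_sub
      ((hx w hw).const_mul 4)).congr_deriv ?_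
    push_cast
    ring
  have hbound := hI.convex.norm_image_sub_le_of_norm_hasDerivWithin_le (C := 0)
    hderiv (fun _ _ => norm_zero.le) hv hu
  rw [zero_mul] at hbound
  exact sub_eq_zero.mp (norm_le_zero_iff.mp hbound)
end

section
/- Normalization of the time shift: let b > 1/2 and set u₀ = (1/(2b))·log(1 + 2b + 2b·√(4b²−1)/(2b−1)). Then u₀ > 0, and the explicit family z̃(u) = b²/sinh²(b(u+u₀)), x̃(u) = (b·coth(b(u+u₀)) − 1)² + 1 − b² satisfies 1 − x̃(0) − z̃(0) = 0, x̃(0) = 1 − (1/2)·√(4b²−1), and z̃(0) = (1/2)·√(4b²−1). -/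
theorem coth_eq_one_add_two_div {w : ℝ} (hw : w ≠ 0) :
    coth w = 1 + 2 / (Real.exp (2*w) - 1) := by
  have hs : Real.sinh w ≠ 0 := Real.sinh_ne_zero.mpr hw
  have he : Real.exp (2*w) - 1 ≠ 0 := by
    rw [sub_ne_zero, Ne, Real.exp_eq_one_iff]
    simpa using hw
  have hexp : Real.exp (2*w) = (Real.cosh w + Real.sinh w)^2 := by
    rw [Real.cosh_add_sinh, ← Real.exp_nat_mul]
    norm_num
  rw [hexp] at he ⊢
  unfold coth
  field_simp
  linear_combination (Real.cosh w + Real.sinh w) * Real.cosh_sq w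

theorem sq_div_sinh_sq {w : ℝ} (hw : w ≠ 0) (b : ℝ) :
    b^2 / Real.sinh w^2 = (b * coth w)^2 - b^2 := by
  have hs : Real.sinh w ≠ 0 := Real.sinh_ne_zero.mpr hw
  unfold coth
  field_simp
  linear_combination -b^2 * Real.cosh_sq w

/-- **Normalization of the time shift:** for `b > 1/2` and
`u₀ = (1/(2b))·log(1 + 2b + 2b·√(4b²−1)/(2b−1))`, one has `u₀ > 0`,
`ỹ(0) = 1 − x̃(0) − z̃(0) = 0`, `x̃(0) = 1 − √(4b²−1)/2` and `z̃(0) = √(4b²−1)/2`. -/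
theorem time_shift_normalization
    (b : ℝ) (hb : 1/2 < b) :
    0 < (1/(2*b)) * Real.log (1 + 2*b + 2*b * Real.sqrt (4*b^2 - 1) / (2*b - 1)) ∧
    1 - ksXt b ((1/(2*b)) * Real.log (1 + 2*b + 2*b * Real.sqrt (4*b^2 - 1) / (2*b - 1))) 0
      - ksZt b ((1/(2*b)) * Real.log (1 + 2*b + 2*b * Real.sqrt (4*b^2 - 1) / (2*b - 1))) 0 = 0 ∧
    ksXt b ((1/(2*b)) * Real.log (1 + 2*b + 2*b * Real.sqrt (4*b^2 - 1) / (2*b - 1))) 0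
      = 1 - (1/2) * Real.sqrt (4*b^2 - 1) ∧
    ksZt b ((1/(2*b)) * Real.log (1 + 2*b + 2*b * Real.sqrt (4*b^2 - 1) / (2*b - 1))) 0
      = (1/2) * Real.sqrt (4*b^2 - 1) := by
  have hb1 : 0 < 2*b - 1 := by linarith
  have hb0 : 0 < b := by linarith
  set s := Real.sqrt (4*b^2 - 1) with hs
  have hs0 : 0 ≤ s := Real.sqrt_nonneg _
  have hs2 : s^2 = 4*b^2 - 1 := Real.sq_sqrt (by nlinarith)
  set E := 1 + 2*b + 2*b * s / (2*b - 1) with hE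
  have hE1 : 1 < E := by
    have : 0 ≤ 2*b * s / (2*b - 1) := by positivity
    linarith
  set u₀ := (1/(2*b)) * Real.log E with hu
  have hu0 : 0 < u₀ := mul_pos (by positivity) (Real.log_pos hE1)
  have hw : b * (0 + u₀) ≠ 0 := by positivity
  have hexp : Real.exp (2 * (b * (0 + u₀))) = E := by
    rw [show 2 * (b * (0 + u₀)) = Real.log E by rw [hu]; field_simp; ring]
    exact Real.exp_log (by linarith)
  have hcoth : b * coth (b * (0 + u₀)) = (s + 1) / 2 := by
    have hsum : 2*b - 1 + s ≠ 0 := by positivity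
    have hEsub : E - 1 = 2*b * (2*b - 1 + s) / (2*b - 1) := by
      rw [hE]
      field_simp
      ring
    rw [coth_eq_one_add_two_div hw, hexp, hEsub]
    have hfrac : 2 / (2*b * (2*b - 1 + s) / (2*b - 1)) = (s - 2*b + 1) / (2*b) := by
      rw [div_div_eq_mul_div, div_eq_div_iff (by positivity) (by positivity)]
      linear_combination -2 * b * hs2
    rw [hfrac]
    field_simp
    ring
  have hx : ksXt b u₀ 0 = 1 - (1/2) * s := by
    rw [ksXt, hcoth]
    linear_combination hs2 / 4
  have hz : ksZt b u₀ 0 = (1/2) * s := by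
    rw [ksZt, sq_div_sinh_sq hw, hcoth]
    linear_combination hs2 / 4
  exact ⟨hu0, by rw [hx, hz]; ring, hx, hz⟩
end

section
/- Second derivative of the first coordinate along the flow: let I be an open interval and (𝒳,𝒴,𝒵) : I → ℝ³ be differentiable with S := 𝒳 + 𝒴 + 𝒵 > 0 on I and (𝒳',𝒴',𝒵')(t) = φ((𝒳,𝒴,𝒵)(t)) for all t ∈ I. Then 𝒳 is twice differentiable on I and 𝒳''(t) = (𝒵(t)/S(t)⁴)·(𝒳(t)² − 2𝒳(t)𝒴(t) + 8𝒴(t)𝒵(t) + 11𝒵(t)²) for all t ∈ I. -/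
/-- **Second derivative of the first coordinate along the flow:** `𝒳` is twice
differentiable (its derivative `t ↦ φ_X(𝒳,𝒴,𝒵)` is differentiable) with the stated
explicit second derivative. -/
theorem second_derivative_X
    (a b : ℝ) (X Y Z : ℝ → ℝ)
    (hSpos : ∀ t ∈ Set.Ioo a b, 0 < X t + Y t + Z t)
    (hX' : ∀ t ∈ Set.Ioo a b, HasDerivAt X (phiX (X t) (Y t) (Z t)) t)
    (hY' : ∀ t ∈ Set.Ioo a b, HasDerivAt Y (phiY (X t) (Y t) (Z t)) t)
    (hZ' : ∀ t ∈ Set.Ioo a b, HasDerivAt Z (phiZ (X t) (Y t) (Z t)) t) :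
    ∀ t ∈ Set.Ioo a b,
      HasDerivAt (fun u => phiX (X u) (Y u) (Z u))
        (Z t / (X t + Y t + Z t)^4
          * (X t^2 - 2 * X t * Y t + 8 * Y t * Z t + 11 * Z t^2)) t := by
  intro t ht
  have hs : X t + Y t + Z t ≠ 0 := (hSpos t ht).ne'
  have hX := hX' t ht
  have hY := hY' t ht
  have hZ := hZ' t ht
  have hS := (hX.add hY).add hZ
  have h₁ := (hX.const_mul (-2)).div hS hs
  have h₂ := (hY.mul hZ).div (hS.pow 2) (pow_ne_zero 2 hs)
  have h₃ := ((hX.const_mul 2).mul hY).div (hS.pow 2) (pow_ne_zero 2 hs)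
  have h₄ := ((((((hY.pow 2).mul hZ).sub (((hX.pow 2).const_mul 3).mul hZ)).sub
    (((hX.const_mul 2).mul hY).mul hZ)).sub (hZ.pow 3)).sub
    ((hX.const_mul 4).mul (hZ.pow 2))).div (hS.pow 3) (pow_ne_zero 3 hs)
  refine (((h₁.sub h₂).sub h₃).add h₄).congr_deriv ?_
  simp only [phiX, phiY, phiZ, Pi.add_apply, Pi.sub_apply, Pi.mul_apply, Pi.pow_apply]
  field_simp
  ring
end

section
/- Second derivatives of the second and third coordinates along the flow: let I be an open interval and (𝒳,𝒴,𝒵) : I → ℝ³ be differentiable with S := 𝒳 + 𝒴 + 𝒵 > 0 on I and (𝒳',𝒴',𝒵')(t) = φ((𝒳,𝒴,𝒵)(t)) for all t ∈ I. Then 𝒴 and 𝒵 are twice differentiable on I with 𝒴''(t) = −2·(𝒵(t)/S(t)⁴)·(𝒳𝒴 + 4𝒴² + 8𝒳𝒵 + 21𝒴𝒵 + 20𝒵²)(t) and 𝒵''(t) = 3·(𝒵(t)/S(t)⁴)·(𝒳² + 4𝒳𝒴 + 4𝒴² + 8𝒳𝒵 + 14𝒴𝒵 + 11𝒵²)(t)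 for all t ∈ I. -/
theorem phiX_eq_div_sq (x y z : ℝ) :
    phiX x y z = (-2*x^2 - 4*x*y - 5*x*z - z^2) / (x+y+z)^2 := by
  unfold phiX
  by_cases h : x + y + z = 0
  · simp [h]
  · field_simp
    ring

theorem phiY_eq_div_sq (x y z : ℝ) :
    phiY x y z = (-2*x*y - 4*y^2 - 4*y*z + 4*z^2) / (x+y+z)^2 := by
  unfold phiY
  by_cases h : x + y + z = 0
  · simp [h]
  · field_simp
    ring

theorem phiZ_eq_div_sq (x y z : ℝ) :
    phiZ x y z = -3*z*(x + 2*y + 3*z) / (x+y+z)^2 := by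
  unfold phiZ
  by_cases h : x + y + z = 0
  · simp [h]
  · field_simp
    ring

/-- **Second derivatives of the second and third coordinates along the flow:** `𝒴` and
`𝒵` are twice differentiable with the stated explicit second derivatives. -/
theorem second_derivative_Y_Z
    (a b : ℝ) (X Y Z : ℝ → ℝ)
    (hSpos : ∀ t ∈ Set.Ioo a b, 0 < X t + Y t + Z t)
    (hX' : ∀ t ∈ Set.Ioo a b, HasDerivAt X (phiX (X t) (Y t) (Z t)) t)
    (hY' : ∀ t ∈ Set.Ioo a b, HasDerivAt Y (phiY (X t) (Y t) (Z t)) t)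
    (hZ' : ∀ t ∈ Set.Ioo a b, HasDerivAt Z (phiZ (X t) (Y t) (Z t)) t) :
    ∀ t ∈ Set.Ioo a b,
      HasDerivAt (fun u => phiY (X u) (Y u) (Z u))
        (-2 * (Z t / (X t + Y t + Z t)^4)
          * (X t * Y t + 4 * Y t^2 + 8 * X t * Z t + 21 * Y t * Z t + 20 * Z t^2)) t ∧
      HasDerivAt (fun u => phiZ (X u) (Y u) (Z u))
        (3 * (Z t / (X t + Y t + Z t)^4)
          * (X t^2 + 4 * X t * Y t + 4 * Y t^2 + 8 * X t * Z t
            + 14 * Y t * Z t + 11 * Z t^2)) t := by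
  intro t ht
  have hs : X t + Y t + Z t ≠ 0 := (hSpos t ht).ne'
  have hX := hX' t ht
  have hY := hY' t ht
  have hZ := hZ' t ht
  rw [phiX_eq_div_sq] at hX
  rw [phiY_eq_div_sq] at hY
  rw [phiZ_eq_div_sq] at hZ
  have hS := ((hX.fun_add hY).fun_add hZ).fun_pow 2
  simp only [phiY_eq_div_sq, phiZ_eq_div_sq]
  constructor
  · have hN := ((((hX.const_mul (-2)).fun_mul hY).fun_sub ((hY.fun_pow 2).const_mul 4)).fun_sub
      ((hY.const_mul 4).fun_mul hZ)).fun_add ((hZ.fun_pow 2).const_mul 4)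
    refine (hN.fun_div hS (pow_ne_zero 2 hs)).congr_deriv ?_
    push_cast
    field_simp
    ring
  · have hN := (hZ.const_mul (-3)).fun_mul
      ((hX.fun_add (hY.const_mul 2)).fun_add (hZ.const_mul 3))
    refine (hN.fun_div hS (pow_ne_zero 2 hs)).congr_deriv ?_
    push_cast
    field_simp
    ring
end

section
/- Asymptotics of the partial derivatives of φ along the critical trajectory: under the critical asymptotic hypotheses on f, g, h, as ε → 0⁺ one has ε·(∂φ_X/∂x)(f(ε),g(ε),h(ε)) → −1, ε^{1/2}·(∂φ_Z/∂y)(f(ε),g(ε),h(ε)) → 3√3/2, and ε·(∂φ_Z/∂z)(f(ε),g(ε),h(ε)) → −3/2; moreover (∂φ_X/∂y)(f(ε),g(ε),h(ε)) and ε^{1/2}·(∂φ_X/∂z)(f(ε),g(ε),h(ε)) remain bounded as ε → 0⁺. -/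
open Filter Topology

theorem deriv_phiX_x {x y z : ℝ} (hs : x + y + z ≠ 0) :
    deriv (fun w => phiX w y z) x =
      (-3*z^3 - 12*y*z^2 - 13*y^2*z - 4*y^3 - 2*x*z^2 - 8*x*y*z - 4*x*y^2 + x^2*z) / (x + y +
        z)^4 := by
  unfold phiX
  simp (discharger := first | assumption | fun_prop (disch := simpa using hs) | positivity)
    [deriv_fun_add, deriv_fun_sub, deriv_fun_mul, deriv_fun_div, deriv_fun_pow]
  field_simp
  ring

theorem deriv_phiX_y {x y z : ℝ} (hs : x + y + z ≠ 0) :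
    deriv (fun w => phiX x w z) y =
      (2*z^3 + 2*y*z^2 + 8*x*z^2 + 10*x*y*z + 4*x*y^2 + 6*x^2*z + 4*x^2*y) / (x + y + z)^4 := by
  unfold phiX
  simp (discharger := first | assumption | fun_prop (disch := simpa using hs) | positivity)
    [deriv_fun_add, deriv_fun_sub, deriv_fun_mul, deriv_fun_div, deriv_fun_pow]
  field_simp
  ring

theorem deriv_phiX_z {x y z : ℝ} (hs : x + y + z ≠ 0) :
    deriv (fun w => phiX x y w) z =
      (-2*y*z^2 - 2*y^2*z + 3*x*z^2 + 4*x*y*z + 3*x*y^2 + 2*x^2*z + 2*x^2*y - x^3) / (x + y +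
        z)^4 := by
  unfold phiX
  simp (discharger := first | assumption | fun_prop (disch := simpa using hs) | positivity)
    [deriv_fun_add, deriv_fun_sub, deriv_fun_mul, deriv_fun_div, deriv_fun_pow]
  field_simp
  ring

theorem deriv_phiZ_y {x y z : ℝ} (hs : x + y + z ≠ 0) :
    deriv (fun w => phiZ x w z) y =
      (12*z^3 + 18*y*z^2 + 6*y^2*z + 12*x*z^2 + 6*x*y*z) / (x + y + z)^4 := by
  unfold phiZ
  simp (discharger := first | assumption | fun_prop (disch := simpa using hs) | positivity)
    [deriv_fun_add, deriv_fun_sub, deriv_fun_mul, deriv_fun_div, deriv_fun_pow]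
  field_simp
  ring

theorem deriv_phiZ_z {x y z : ℝ} (hs : x + y + z ≠ 0) :
    deriv (fun w => phiZ x y w) z =
      (-12*y*z^2 - 18*y^2*z - 6*y^3 - 15*x*z^2 - 36*x*y*z - 15*x*y^2 - 18*x^2*z - 12*x^2*y -
        3*x^3) / (x + y + z)^4 := by
  unfold phiZ
  simp (discharger := first | assumption | fun_prop (disch := simpa using hs) | positivity)
    [deriv_fun_add, deriv_fun_sub, deriv_fun_mul, deriv_fun_div, deriv_fun_pow]
  field_simp
  ring

theorem parabolic_sum_ne_zero {t X Y Z : ℝ} (ht : t ≠ 0) (hS : t^2*X + Y + t*Z ≠ 0) :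
    t^4*X + t^2*Y + t^3*Z ≠ 0 := by
  have : t^4*X + t^2*Y + t^3*Z = t^2*(t^2*X + Y + t*Z) := by ring
  rw [this]
  positivity

theorem scaled_deriv_phiX_x {t X Y Z : ℝ} (ht : t ≠ 0) (hS : t^2*X + Y + t*Z ≠ 0) :
    t^2 * deriv (fun w => phiX w (t^2*Y) (t^3*Z)) (t^4*X) =
      (-3*t^3*Z^3 - 12*t^2*Y*Z^2 - 13*t*Y^2*Z - 4*Y^3 - 2*t^4*X*Z^2 - 8*t^3*X*Y*Z - 4*t^2*X*Y^2 +
        t^5*X^2*Z)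
        / (t^2*X + Y + t*Z)^4 := by
  have hs := parabolic_sum_ne_zero ht hS
  rw [deriv_phiX_x hs]
  field_simp

theorem scaled_deriv_phiX_y {t X Y Z : ℝ} (ht : t ≠ 0) (hS : t^2*X + Y + t*Z ≠ 0) :
    deriv (fun w => phiX (t^4*X) w (t^3*Z)) (t^2*Y) =
      (2*t*Z^3 + 2*Y*Z^2 + 8*t^2*X*Z^2 + 10*t*X*Y*Z + 4*X*Y^2 + 6*t^3*X^2*Z + 4*t^2*X^2*Y)
        / (t^2*X + Y + t*Z)^4 := by
  have hs := parabolic_sum_ne_zero ht hS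
  rw [deriv_phiX_y hs]
  field_simp

theorem scaled_deriv_phiX_z {t X Y Z : ℝ} (ht : t ≠ 0) (hS : t^2*X + Y + t*Z ≠ 0) :
    t * deriv (fun w => phiX (t^4*X) (t^2*Y) w) (t^3*Z) =
      (-2*t*Y*Z^2 - 2*Y^2*Z + 3*t^3*X*Z^2 + 4*t^2*X*Y*Z + 3*t*X*Y^2 + 2*t^4*X^2*Z + 2*t^3*X^2*Y -
        t^5*X^3)
        / (t^2*X + Y + t*Z)^4 := by
  have hs := parabolic_sum_ne_zero ht hS
  rw [deriv_phiX_z hs]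
  field_simp

theorem scaled_deriv_phiZ_y {t X Y Z : ℝ} (ht : t ≠ 0) (hS : t^2*X + Y + t*Z ≠ 0) :
    t * deriv (fun w => phiZ (t^4*X) w (t^3*Z)) (t^2*Y) =
      (12*t^2*Z^3 + 18*t*Y*Z^2 + 6*Y^2*Z + 12*t^3*X*Z^2 + 6*t^2*X*Y*Z)
        / (t^2*X + Y + t*Z)^4 := by
  have hs := parabolic_sum_ne_zero ht hS
  rw [deriv_phiZ_y hs]
  field_simp

theorem scaled_deriv_phiZ_z {t X Y Z : ℝ} (ht : t ≠ 0) (hS : t^2*X + Y + t*Z ≠ 0) :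
    t^2 * deriv (fun w => phiZ (t^4*X) (t^2*Y) w) (t^3*Z) =
      (-12*t^2*Y*Z^2 - 18*t*Y^2*Z - 6*Y^3 - 15*t^4*X*Z^2 - 36*t^3*X*Y*Z - 15*t^2*X*Y^2 -
        18*t^5*X^2*Z - 12*t^4*X^2*Y - 3*t^6*X^3)
        / (t^2*X + Y + t*Z)^4 := by
  have hs := parabolic_sum_ne_zero ht hS
  rw [deriv_phiZ_z hs]
  field_simp

theorem tendsto_div_scaled_sum {α : Type*} {l : Filter α} {T X Y Z : α → ℝ} {a b c : ℝ}
    (hb : b ≠ 0) (hT : Tendsto T l (𝓝 0)) (hX : Tendsto X l (𝓝 a)) (hY : Tendsto Y l (𝓝 b))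
    (hZ : Tendsto Z l (𝓝 c)) {F : ℝ × ℝ × ℝ × ℝ → ℝ} (hF : Continuous F) :
    Tendsto (fun i => F (T i, X i, Y i, Z i) / (T i^2 * X i + Y i + T i * Z i)^4) l
      (𝓝 (F (0, a, b, c) / b^4)) := by
  have hS : Tendsto (fun i => T i^2 * X i + Y i + T i * Z i) l (𝓝 b) := by
    simpa using (((hT.pow 2).mul hX).add hY).add (hT.mul hZ)
  have hp : Tendsto (fun i => (T i, X i, Y i, Z i)) l (𝓝 (0, a, b, c)) :=
    hT.prodMk_nhds (hX.prodMk_nhds (hY.prodMk_nhds hZ))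
  exact ((hF.tendsto _).comp hp).div (hS.pow 4) (pow_ne_zero 4 hb)

/-- **Asymptotics of the partial derivatives of φ along the critical trajectory.** -/
theorem partial_derivatives_asymptotics_critical
    (η : ℝ) (hη : 0 < η) (f g h : ℝ → ℝ)
    (hfnn : ∀ ε ∈ Set.Ioo (0:ℝ) η, 0 ≤ f ε)
    (hgnn : ∀ ε ∈ Set.Ioo (0:ℝ) η, 0 ≤ g ε)
    (hhnn : ∀ ε ∈ Set.Ioo (0:ℝ) η, 0 ≤ h ε)
    (hf : Tendsto (fun ε => f ε / (3 * ε^2)) (nhdsWithin 0 (Set.Ioi 0)) (nhds 1))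
    (hg : Tendsto (fun ε => g ε / (4 * ε)) (nhdsWithin 0 (Set.Ioi 0)) (nhds 1))
    (hh : Tendsto (fun ε => h ε / (4 * Real.sqrt 3 * ε ^ ((3:ℝ)/2)))
      (nhdsWithin 0 (Set.Ioi 0)) (nhds 1)) :
    Tendsto (fun ε => ε * deriv (fun x => phiX x (g ε) (h ε)) (f ε))
      (nhdsWithin 0 (Set.Ioi 0)) (nhds (-1)) ∧
    Tendsto (fun ε => Real.sqrt ε * deriv (fun y => phiZ (f ε) y (h ε)) (g ε))
      (nhdsWithin 0 (Set.Ioi 0)) (nhds (3 * Real.sqrt 3 / 2)) ∧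
    Tendsto (fun ε => ε * deriv (fun z => phiZ (f ε) (g ε) z) (h ε))
      (nhdsWithin 0 (Set.Ioi 0)) (nhds (-3/2)) ∧
    (∃ C : ℝ, ∀ᶠ ε in nhdsWithin (0:ℝ) (Set.Ioi 0),
      |deriv (fun y => phiX (f ε) y (h ε)) (g ε)| ≤ C ∧
      |Real.sqrt ε * deriv (fun z => phiX (f ε) (g ε) z) (h ε)| ≤ C) := by
  set l := nhdsWithin (0:ℝ) (Set.Ioi 0)
  let X : ℝ → ℝ := fun ε => f ε / √ε^4
  let Y : ℝ → ℝ := fun ε => g ε / √ε^2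
  let Z : ℝ → ℝ := fun ε => h ε / √ε^3
  have hpos : ∀ᶠ ε in l, 0 < ε := self_mem_nhdsWithin
  have hT : Tendsto (fun ε => √ε) l (𝓝 0) := by
    simpa using (Real.continuous_sqrt.tendsto 0).mono_left nhdsWithin_le_nhds
  have hX : Tendsto X l (𝓝 3) := by
    refine Tendsto.congr' ?_ (by simpa using hf.const_mul 3)
    filter_upwards [hpos] with ε hε
    have : √ε^4 = ε^2 := by rw [show √ε^4 = (√ε^2)^2 by ring, Real.sq_sqrt hε.le]
    simp only [X, this]
    field_simp
  have hY : Tendsto Y l (𝓝 4) := by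
    refine Tendsto.congr' ?_ (by simpa using hg.const_mul 4)
    filter_upwards [hpos] with ε hε
    simp only [Y, Real.sq_sqrt hε.le]
    field_simp
  have hZ : Tendsto Z l (𝓝 (4 * √3)) := by
    refine Tendsto.congr' ?_ (by simpa using hh.const_mul (4 * √3))
    filter_upwards [hpos] with ε hε
    have : ε ^ ((3:ℝ)/2) = √ε^3 := by
      rw [Real.sqrt_eq_rpow, ← Real.rpow_natCast, ← Real.rpow_mul hε.le]
      norm_num
    simp only [Z, this]
    field_simp
  have hS : ∀ᶠ ε in l, √ε^2 * X ε + Y ε + √ε * Z ε ≠ 0 := by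
    have : Tendsto (fun ε => √ε^2 * X ε + Y ε + √ε * Z ε) l (𝓝 4) := by
      simpa using (((hT.pow 2).mul hX).add hY).add (hT.mul hZ)
    exact this.eventually_ne (by norm_num)
  have hev : ∀ᶠ ε in l, √ε ≠ 0 ∧ √ε^2 = ε ∧ √ε^4 * X ε = f ε ∧ √ε^2 * Y ε = g ε ∧
      √ε^3 * Z ε = h ε := by
    filter_upwards [hpos] with ε hε
    have ht : √ε ≠ 0 := (Real.sqrt_pos.2 hε).ne'
    exact ⟨ht, Real.sq_sqrt hε.le, mul_div_cancel₀ _ (pow_ne_zero 4 ht),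
      mul_div_cancel₀ _ (pow_ne_zero 2 ht), mul_div_cancel₀ _ (pow_ne_zero 3 ht)⟩
  have key {F : ℝ × ℝ × ℝ × ℝ → ℝ} (hF : Continuous F) :=
    tendsto_div_scaled_sum (by norm_num) hT hX hY hZ hF
  have hXx : Tendsto (fun ε => ε * deriv (fun x => phiX x (g ε) (h ε)) (f ε)) l
      (𝓝 (-1)) := by
    have hlim := key (F := fun p =>
      -3*p.1^3*p.2.2.2^3 - 12*p.1^2*p.2.2.1*p.2.2.2^2 - 13*p.1*p.2.2.1^2*p.2.2.2 - 4*p.2.2.1^3 -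
        2*p.1^4*p.2.1*p.2.2.2^2 - 8*p.1^3*p.2.1*p.2.2.1*p.2.2.2 - 4*p.1^2*p.2.1*p.2.2.1^2 +
        p.1^5*p.2.1^2*p.2.2.2) (by fun_prop)
    convert hlim.congr' ?_ using 2
    · ring
    filter_upwards [hev, hS] with ε ⟨ht, ht2, hf', hg', hh'⟩ hSε
    have hd := scaled_deriv_phiX_x ht hSε
    rw [hf', hg', hh'] at hd
    exact hd.symm.trans (by rw [ht2])
  have hZy : Tendsto (fun ε => √ε * deriv (fun y => phiZ (f ε) y (h ε)) (g ε)) l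
      (𝓝 (3 * √3 / 2)) := by
    have hlim := key (F := fun p =>
      12*p.1^2*p.2.2.2^3 + 18*p.1*p.2.2.1*p.2.2.2^2 + 6*p.2.2.1^2*p.2.2.2 +
        12*p.1^3*p.2.1*p.2.2.2^2 + 6*p.1^2*p.2.1*p.2.2.1*p.2.2.2) (by fun_prop)
    convert hlim.congr' ?_ using 2
    · ring
    filter_upwards [hev, hS] with ε ⟨ht, _, hf', hg', hh'⟩ hSε
    have hd := scaled_deriv_phiZ_y ht hSε
    rw [hf', hg', hh'] at hd
    exact hd.symm
  have hZz : Tendsto (fun ε => ε * deriv (fun z => phiZ (f ε) (g ε) z) (h ε)) l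
      (𝓝 (-3/2)) := by
    have hlim := key (F := fun p =>
      -12*p.1^2*p.2.2.1*p.2.2.2^2 - 18*p.1*p.2.2.1^2*p.2.2.2 - 6*p.2.2.1^3 -
        15*p.1^4*p.2.1*p.2.2.2^2 - 36*p.1^3*p.2.1*p.2.2.1*p.2.2.2 - 15*p.1^2*p.2.1*p.2.2.1^2 -
        18*p.1^5*p.2.1^2*p.2.2.2 - 12*p.1^4*p.2.1^2*p.2.2.1 - 3*p.1^6*p.2.1^3) (by fun_prop)
    convert hlim.congr' ?_ using 2
    · ring
    filter_upwards [hev, hS] with ε ⟨ht, ht2, hf', hg', hh'⟩ hSε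
    have hd := scaled_deriv_phiZ_z ht hSε
    rw [hf', hg', hh'] at hd
    exact hd.symm.trans (by rw [ht2])
  have hXy : Tendsto (fun ε => deriv (fun y => phiX (f ε) y (h ε)) (g ε)) l
      (𝓝 (9 / 4)) := by
    have hlim := key (F := fun p =>
      2*p.1*p.2.2.2^3 + 2*p.2.2.1*p.2.2.2^2 + 8*p.1^2*p.2.1*p.2.2.2^2 +
        10*p.1*p.2.1*p.2.2.1*p.2.2.2 + 4*p.2.1*p.2.2.1^2 + 6*p.1^3*p.2.1^2*p.2.2.2 +
        4*p.1^2*p.2.1^2*p.2.2.1) (by fun_prop)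
    convert hlim.congr' ?_ using 2
    · ring_nf; norm_num
    filter_upwards [hev, hS] with ε ⟨ht, _, hf', hg', hh'⟩ hSε
    have hd := scaled_deriv_phiX_y ht hSε
    rw [hf', hg', hh'] at hd
    exact hd.symm
  have hXz : Tendsto (fun ε => √ε * deriv (fun z => phiX (f ε) (g ε) z) (h ε)) l
      (𝓝 (-√3 / 2)) := by
    have hlim := key (F := fun p =>
      -2*p.1*p.2.2.1*p.2.2.2^2 - 2*p.2.2.1^2*p.2.2.2 + 3*p.1^3*p.2.1*p.2.2.2^2 +
        4*p.1^2*p.2.1*p.2.2.1*p.2.2.2 + 3*p.1*p.2.1*p.2.2.1^2 + 2*p.1^4*p.2.1^2*p.2.2.2 +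
        2*p.1^3*p.2.1^2*p.2.2.1 - p.1^5*p.2.1^3) (by fun_prop)
    convert hlim.congr' ?_ using 2
    · ring
    filter_upwards [hev, hS] with ε ⟨ht, _, hf', hg', hh'⟩ hSε
    have hd := scaled_deriv_phiX_z ht hSε
    rw [hf', hg', hh'] at hd
    exact hd.symm
  obtain ⟨A, hA⟩ := hXy.abs.isBoundedUnder_le
  obtain ⟨B, hB⟩ := hXz.abs.isBoundedUnder_le
  refine ⟨hXx, hZy, hZz, max A B, ?_⟩
  filter_upwards [eventually_map.1 hA, eventually_map.1 hB] with ε h₁ h₂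
  exact ⟨h₁.trans (le_max_left A B), h₂.trans (le_max_right A B)⟩
end

section
/- Asymptotics of the second-moment function ψ_X along the critical trajectory: under the critical asymptotic hypotheses on f, g, h, one has ψ_X(f(ε), g(ε), h(ε)) ~ 2√3·√ε as ε → 0⁺, i.e. ψ_X(f(ε),g(ε),h(ε))/√ε → 2√3. -/
/-- Fluid-limit approximation of the conditional second moment of the increments of `X`. -/
noncomputable def psiX (x y z : ℝ) : ℝ :=
  4*x/(x+y+z) + 4*x*y/(x+y+z)^2 + y*z/(x+y+z)^2
    + (y^2*z + 9*x^2*z + 2*x*y*z + 2*x*z^2 + z^3)/(x+y+z)^3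

open Filter Topology

/-- Rescaling of `psiX` by `x = 3at⁴`, `y = 4bt²`, `z = 4rct³`: after division by `t`, the common
powers of `t` cancel. -/
theorem psiX_rescaled (r t a b c : ℝ) (ht : t ≠ 0)
    (hσ : 3 * a * t ^ 2 + 4 * b + 4 * r * c * t ≠ 0) :
    psiX (3 * a * t ^ 4) (4 * b * t ^ 2) (4 * r * c * t ^ 3) / t =
      12 * a * t / (3 * a * t ^ 2 + 4 * b + 4 * r * c * t)
      + (48 * a * b * t + 16 * r * b * c) / (3 * a * t ^ 2 + 4 * b + 4 * r * c * t) ^ 2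
      + (64 * r * b ^ 2 * c + 324 * r * a ^ 2 * c * t ^ 4 + 96 * r * a * b * c * t ^ 2
          + 96 * r ^ 2 * a * c ^ 2 * t ^ 3 + 64 * r ^ 3 * c ^ 3 * t ^ 2)
        / (3 * a * t ^ 2 + 4 * b + 4 * r * c * t) ^ 3 := by
  have hs : 3 * a * t ^ 4 + 4 * b * t ^ 2 + 4 * r * c * t ^ 3
      = t ^ 2 * (3 * a * t ^ 2 + 4 * b + 4 * r * c * t) := by ring
  rw [psiX, hs]
  generalize 3 * a * t ^ 2 + 4 * b + 4 * r * c * t = σ at hσ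
  field_simp
  ring

/-- **Asymptotics of the second-moment function ψ_X along the critical trajectory:**
`ψ_X(f(ε),g(ε),h(ε)) ~ 2√3·√ε` as `ε → 0⁺`. -/
theorem psiX_asymptotics_critical
    (η : ℝ) (hη : 0 < η) (f g h : ℝ → ℝ)
    (hfnn : ∀ ε ∈ Set.Ioo (0:ℝ) η, 0 ≤ f ε)
    (hgnn : ∀ ε ∈ Set.Ioo (0:ℝ) η, 0 ≤ g ε)
    (hhnn : ∀ ε ∈ Set.Ioo (0:ℝ) η, 0 ≤ h ε)
    (hf : Tendsto (fun ε => f ε / (3 * ε^2)) (nhdsWithin 0 (Set.Ioi 0)) (nhds 1))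
    (hg : Tendsto (fun ε => g ε / (4 * ε)) (nhdsWithin 0 (Set.Ioi 0)) (nhds 1))
    (hh : Tendsto (fun ε => h ε / (4 * Real.sqrt 3 * ε ^ ((3:ℝ)/2)))
      (nhdsWithin 0 (Set.Ioi 0)) (nhds 1)) :
    Tendsto (fun ε => psiX (f ε) (g ε) (h ε) / Real.sqrt ε)
      (nhdsWithin 0 (Set.Ioi 0)) (nhds (2 * Real.sqrt 3)) := by
  set l : Filter ℝ := nhdsWithin 0 (Set.Ioi 0)
  have hpos : ∀ᶠ ε : ℝ in l, 0 < ε := self_mem_nhdsWithin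
  have ht : Tendsto Real.sqrt l (nhds 0) := by
    simpa using (Real.continuous_sqrt.tendsto 0).mono_left nhdsWithin_le_nhds
  have hσ := ((hf.const_mul 3).mul (ht.pow 2)).add (hg.const_mul 4) |>.add
    ((hh.const_mul (4 * Real.sqrt 3)).mul ht)
  have hσ0 := hσ.eventually_ne (show _ ≠ (0:ℝ) by norm_num)
  have hlim := ((((hf.const_mul 12).mul ht).div hσ (by norm_num)).add
    (((((hf.const_mul 48).mul hg).mul ht).add ((hg.const_mul (16 * Real.sqrt 3)).mul hh)).div
      (hσ.pow 2) (by norm_num))).add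
    (((((((hg.pow 2).const_mul (64 * Real.sqrt 3)).mul hh).add
      ((((hf.pow 2).const_mul (324 * Real.sqrt 3)).mul hh).mul (ht.pow 4))).add
      ((((hf.const_mul (96 * Real.sqrt 3)).mul hg).mul hh).mul (ht.pow 2))).add
      (((hf.const_mul (96 * Real.sqrt 3 ^ 2)).mul (hh.pow 2)).mul (ht.pow 3))).add
      (((hh.pow 3).const_mul (64 * Real.sqrt 3 ^ 3)).mul (ht.pow 2)) |>.div
      (hσ.pow 3) (by norm_num))
  convert hlim.congr' ?_ using 2
  · ring
  filter_upwards [hpos, hσ0] with ε hε hne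
  have hr : Real.sqrt 3 ≠ 0 := by positivity
  have htε : Real.sqrt ε ≠ 0 := (Real.sqrt_pos.2 hε).ne'
  have hsq : Real.sqrt ε ^ 2 = ε := Real.sq_sqrt hε.le
  have hpow : ε ^ ((3:ℝ)/2) = Real.sqrt ε ^ 3 := by
    rw [Real.sqrt_eq_rpow, ← Real.rpow_natCast, ← Real.rpow_mul hε.le]
    norm_num
  have hf' : 3 * (f ε / (3 * ε ^ 2)) * Real.sqrt ε ^ 4 = f ε := by
    rw [show Real.sqrt ε ^ 4 = (Real.sqrt ε ^ 2) ^ 2 by ring, hsq]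
    field_simp
  have hg' : 4 * (g ε / (4 * ε)) * Real.sqrt ε ^ 2 = g ε := by
    rw [hsq]
    field_simp
  have hh' : 4 * Real.sqrt 3 * (h ε / (4 * Real.sqrt 3 * ε ^ ((3:ℝ)/2))) * Real.sqrt ε ^ 3
      = h ε := by
    rw [hpow]
    field_simp
  have key := psiX_rescaled (Real.sqrt 3) (Real.sqrt ε) _ _ _ htε hne
  rw [hf', hg', hh'] at key
  exact key.symm
end
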